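/- arXiv:2408.06801 — 2 statements merged into one kernel-verified Lean document; each statement's English description precedes it below -/
import Mathlib

section
/- a-contraction estimate on the compressive part of the shock (Lemma 4.3): Let φ : ℝ → ℝ be continuously differentiable with φ and φ′ square-integrable. Then ∫_{−∞}^{ξ_*} μ w(u^S) (φ′)² dξ + ∫_{−∞}^{ξ_*} φ² (u^S)′ [σ w′(u^S) − 3(u^S)² w′(u^S) + 3 u^S w(u^S) − (w″(u^S)/2) μ (u^S)′] dξ + (8/(25u_m²)) (∫_{−∞}^{ξ_*} φ w(u^S) (u^S)′ dξ)² ≥ (1/6) ∫_{−∞}^{ξ_*} μ w(u^S) (φ′)² dξ + (4/5) u_m³ ∫_{−∞}^{ξ_*} φ² (u^S)′ dξ. -/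
open MeasureTheory Filter Set Topology

/-- The weight `w` for `u_m = 1`, on `s ≤ 1/2`. -/
noncomputable def unitWeight (s : ℝ) : ℝ :=
  5 / 2 * (1 - s) * (1 + 4 * max s 0 ^ 3)

/-- The zeroth-order coefficient `3(1 - s²)w' + 3sw - w''(s + 2)(1 - s)²/2 - 4/5` for `u_m = 1`,
on `s ≤ 1/2`. -/
noncomputable def unitReaction (s : ℝ) : ℝ :=
  15 / 2 * ((1 - s ^ 2) * (-1 + 12 * max s 0 ^ 2 - 16 * max s 0 ^ 3)
    + s * (1 - s) * (1 + 4 * max s 0 ^ 3)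
    - (4 * max s 0 - 8 * max s 0 ^ 2) * ((s + 2) * (1 - s) ^ 2)) - 4 / 5

lemma continuous_unitWeight : Continuous unitWeight := by
  unfold unitWeight; fun_prop

lemma continuous_unitReaction : Continuous unitReaction := by
  unfold unitReaction; fun_prop

lemma unitWeight_of_nonpos {s : ℝ} (hs : s ≤ 0) : unitWeight s = 5 / 2 * (1 - s) := by
  simp [unitWeight, max_eq_right hs]

lemma unitReaction_of_nonpos {s : ℝ} (hs : s ≤ 0) :
    unitReaction s = -(15 / 2) * (1 - s) - 4 / 5 := by
  simp only [unitReaction, max_eq_right hs]; ring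

lemma unitWeight_of_nonneg {s : ℝ} (hs : 0 ≤ s) :
    unitWeight s = 5 / 2 * (1 - s) * (1 + 4 * s ^ 3) := by
  simp [unitWeight, max_eq_left hs]

lemma unitReaction_of_nonneg {s : ℝ} (hs : 0 ≤ s) :
    unitReaction s = -83 / 10 - 105 / 2 * s + 300 * s ^ 2 - 300 * s ^ 3 - 90 * s ^ 4
      + 150 * s ^ 5 := by
  simp only [unitReaction, max_eq_left hs]; ring

lemma unitWeight_pos {s : ℝ} (hs : s < 1) : 0 < unitWeight s := by
  have h : 0 < 1 - s := by linarith
  unfold unitWeight; positivity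

/-- A Riccati inequality for `k` bounds the energy density from below by a total derivative. -/
lemma riccati_density_le {ν b h P k k' q w M d η A : ℝ} (hν : 0 < ν) (hb : 0 < b) (hh : 0 < h)
    (hP : 0 < P) (hric : b * P * (k' + h - q) + k ^ 2 ≤ 0) :
    2 * k * η * d + (k' * η ^ 2 + (q + 2 * M * w - (q + M * w) ^ 2 / h) * A ^ 2) * (P / ν)
      ≤ b * ν * d ^ 2 + (q * (η + A) ^ 2 + 2 * M * A * w * (η + A)) * (P / ν) := by
  have key : b * ν * d ^ 2 + (q * (η + A) ^ 2 + 2 * M * A * w * (η + A)) * (P / ν)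
      - (2 * k * η * d + (k' * η ^ 2 + (q + 2 * M * w - (q + M * w) ^ 2 / h) * A ^ 2) * (P / ν))
      = (b * ν * d - k * η) ^ 2 / (b * ν) + -(b * P * (k' + h - q) + k ^ 2) * η ^ 2 / (b * ν)
        + (h * η + (q + M * w) * A) ^ 2 / h * (P / ν) := by
    field_simp
    ring
  have hric' : 0 ≤ -(b * P * (k' + h - q) + k ^ 2) := by linarith
  have : 0 ≤ (b * ν * d - k * η) ^ 2 / (b * ν)
      + -(b * P * (k' + h - q) + k ^ 2) * η ^ 2 / (b * ν)
      + (h * η + (q + M * w) * A) ^ 2 / h * (P / ν) := by positivity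
  linarith

/-- The Riccati lower bound integrated over a piece of the profile. -/
lemma riccati_segment {ν : ℝ} (hν : 0 < ν) {v φ : ℝ → ℝ} (hv : ContDiff ℝ 1 v)
    (hφ : ContDiff ℝ 1 φ) (hv1 : ∀ ξ, v ξ ∈ Ioo (-2) 1)
    (hode : ∀ ξ, deriv v ξ = (v ξ + 2) * (1 - v ξ) ^ 2 / ν)
    {k k' N : ℝ → ℝ} {h M A a b lo hi : ℝ} (hh : 0 < h) (hab : a ≤ b)
    (hmem : ∀ ξ ∈ Icc a b, v ξ ∈ Icc lo hi)
    (hk : ∀ s ∈ Icc lo hi, HasDerivAt k (k' s) s)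
    (hN : ∀ s ∈ Icc lo hi, HasDerivAt N (unitReaction s + 2 * M * unitWeight s
      - (unitReaction s + M * unitWeight s) ^ 2 / h) s)
    (hric : ∀ s ∈ Icc lo hi, 5 / 6 * unitWeight s * ((s + 2) * (1 - s) ^ 2)
      * (k' s + h - unitReaction s) + k s ^ 2 ≤ 0) :
    (k (v b) * (φ b - A) ^ 2 + N (v b) * A ^ 2) - (k (v a) * (φ a - A) ^ 2 + N (v a) * A ^ 2)
      ≤ ∫ ξ in a..b, (5 / 6 * (ν * unitWeight (v ξ) * deriv φ ξ ^ 2)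
        + φ ξ ^ 2 * deriv v ξ * unitReaction (v ξ)
        + 2 * M * A * (φ ξ * unitWeight (v ξ) * deriv v ξ)) := by
  have hvd : ∀ ξ, HasDerivAt v (deriv v ξ) ξ := fun ξ =>
    (hv.differentiable one_ne_zero ξ).hasDerivAt
  have hφd : ∀ ξ, HasDerivAt φ (deriv φ ξ) ξ := fun ξ =>
    (hφ.differentiable one_ne_zero ξ).hasDerivAt
  have hd : ∀ ξ ∈ Icc a b, HasDerivAt (fun ξ => k (v ξ) * (φ ξ - A) ^ 2 + N (v ξ) * A ^ 2)
      (2 * k (v ξ) * (φ ξ - A) * deriv φ ξ + (k' (v ξ) * (φ ξ - A) ^ 2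
        + (unitReaction (v ξ) + 2 * M * unitWeight (v ξ)
          - (unitReaction (v ξ) + M * unitWeight (v ξ)) ^ 2 / h) * A ^ 2)
        * ((v ξ + 2) * (1 - v ξ) ^ 2 / ν)) ξ := by
    intro ξ hξ
    have h1 := (hk _ (hmem ξ hξ)).comp ξ (hvd ξ)
    have h2 := (hN _ (hmem ξ hξ)).comp ξ (hvd ξ)
    have h3 := ((hφd ξ).sub_const A).pow 2
    refine ((h1.mul h3).add (h2.mul_const (A ^ 2))).congr_deriv ?_
    simp only [Function.comp_apply, Pi.pow_apply, hode]
    push_cast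
    ring
  have hcv := hv.continuous
  have hcφ := hφ.continuous
  have hcv' := hv.continuous_deriv le_rfl
  have hcφ' := hφ.continuous_deriv le_rfl
  have hcw := continuous_unitWeight
  have hcq := continuous_unitReaction
  refine intervalIntegral.sub_le_integral_of_hasDeriv_right_of_le hab
    (fun ξ hξ => (hd ξ hξ).continuousAt.continuousWithinAt)
    (fun ξ hξ => (hd ξ (Ioo_subset_Icc_self hξ)).hasDerivWithinAt)
    (Continuous.integrableOn_Icc (by fun_prop)) ?_
  intro ξ hξ
  obtain ⟨hl, hr⟩ := hv1 ξ
  have hp : 0 < (v ξ + 2) * (1 - v ξ) ^ 2 := by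
    have h1 : 0 < v ξ + 2 := by linarith
    have h2 : 0 < 1 - v ξ := by linarith
    positivity
  have := riccati_density_le (M := M) (w := unitWeight (v ξ)) (d := deriv φ ξ) (η := φ ξ - A)
    (A := A) hν (mul_pos (by norm_num : (0 : ℝ) < 5 / 6) (unitWeight_pos hr)) hh hp
    (hric _ (hmem ξ (Ioo_subset_Icc_self hξ)))
  rw [hode]
  refine this.trans (le_of_eq ?_)
  ring

/-- The Riccati multiplier on `[-2, -9/10]`. -/
lemma riccati_left {s : ℝ} (hs : s ∈ Icc (-2 : ℝ) (-9 / 10)) :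
    HasDerivAt (fun s : ℝ => -500 * (s + 2) / (17 + 7 * (s + 2) - 20 * (s + 2) ^ 2))
      (-500 * (17 + 20 * (s + 2) ^ 2) / (17 + 7 * (s + 2) - 20 * (s + 2) ^ 2) ^ 2) s ∧
    5 / 6 * unitWeight s * ((s + 2) * (1 - s) ^ 2)
      * (-500 * (17 + 20 * (s + 2) ^ 2) / (17 + 7 * (s + 2) - 20 * (s + 2) ^ 2) ^ 2
        + 3 / 10 - unitReaction s)
      + (-500 * (s + 2) / (17 + 7 * (s + 2) - 20 * (s + 2) ^ 2)) ^ 2 ≤ 0 := by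
  obtain ⟨h1, h2⟩ := hs
  have hB : 0 < 17 + 7 * (s + 2) - 20 * (s + 2) ^ 2 := by nlinarith
  constructor
  · have hx : HasDerivAt (fun s : ℝ => s + 2) 1 s := (hasDerivAt_id s).add_const 2
    refine ((hx.const_mul (-500)).div (((hx.const_mul 7).const_add 17).sub
      ((hx.pow 2).const_mul 20)) hB.ne').congr_deriv ?_
    simp only [Pi.sub_apply, Pi.pow_apply]
    congr 1
    push_cast
    ring
  · rw [unitWeight_of_nonpos (by linarith), unitReaction_of_nonpos (by linarith)]
    obtain ⟨t, rfl⟩ : ∃ t, s = 11 / 10 * t - 2 := ⟨(s + 2) * 10 / 11, by ring⟩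
    have ht : 0 ≤ t := by linarith
    have ht' : 0 ≤ 1 - t := by linarith
    have hcert : 0 ≤ 188955/2 * (1 - t) ^ 8 + 2615509/16 * t * (1 - t) ^ 7
          + 93994429/160 * t ^ 2 * (1 - t) ^ 6 + 1648852409/480 * t ^ 3 * (1 - t) ^ 5
          + 56876568247/8000 * t ^ 4 * (1 - t) ^ 4
          + 3211264467559/480000 * t ^ 5 * (1 - t) ^ 3
          + 976122239761/320000 * t ^ 6 * (1 - t) ^ 2 + 1171781833/2000 * t ^ 7 * (1 - t)
          + 247175429/12800 * t ^ 8 := by positivity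
    set B := 17 + 7 * (11 / 10 * t - 2 + 2) - 20 * (11 / 10 * t - 2 + 2) ^ 2 with hBdef
    have key : 5 / 6 * (5 / 2 * (1 - (11 / 10 * t - 2)))
        * ((11 / 10 * t - 2 + 2) * (1 - (11 / 10 * t - 2)) ^ 2)
        * (-500 * (17 + 20 * (11 / 10 * t - 2 + 2) ^ 2) / B ^ 2 + 3 / 10
          - (-(15 / 2) * (1 - (11 / 10 * t - 2)) - 4 / 5))
        + (-500 * (11 / 10 * t - 2 + 2) / B) ^ 2
        = -(11 / 10 * t * (188955/2 * (1 - t) ^ 8 + 2615509/16 * t * (1 - t) ^ 7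
          + 93994429/160 * t ^ 2 * (1 - t) ^ 6 + 1648852409/480 * t ^ 3 * (1 - t) ^ 5
          + 56876568247/8000 * t ^ 4 * (1 - t) ^ 4
          + 3211264467559/480000 * t ^ 5 * (1 - t) ^ 3
          + 976122239761/320000 * t ^ 6 * (1 - t) ^ 2 + 1171781833/2000 * t ^ 7 * (1 - t)
          + 247175429/12800 * t ^ 8) / B ^ 2) := by
      field_simp
      rw [hBdef]
      ring
    rw [key, neg_nonpos]
    positivity

/-- The Riccati multiplier on `[-9/10, 0]`. -/
lemma riccati_middle {s : ℝ} (hs : s ∈ Icc (-9 / 10 : ℝ) 0) :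
    HasDerivAt (fun s : ℝ => 1000 * (1 - s) ^ 2 / (317 - 100 * (1 - s) - 35 * (1 - s) ^ 2))
      (-1000 * (1 - s) * (634 - 100 * (1 - s))
        / (317 - 100 * (1 - s) - 35 * (1 - s) ^ 2) ^ 2) s ∧
    5 / 6 * unitWeight s * ((s + 2) * (1 - s) ^ 2)
      * (-1000 * (1 - s) * (634 - 100 * (1 - s))
        / (317 - 100 * (1 - s) - 35 * (1 - s) ^ 2) ^ 2 + 3 / 10 - unitReaction s)
      + (1000 * (1 - s) ^ 2 / (317 - 100 * (1 - s) - 35 * (1 - s) ^ 2)) ^ 2 ≤ 0 := by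
  obtain ⟨h1, h2⟩ := hs
  have hB : 0 < 317 - 100 * (1 - s) - 35 * (1 - s) ^ 2 := by nlinarith
  constructor
  · have hx : HasDerivAt (fun s : ℝ => 1 - s) (-1) s := (hasDerivAt_id s).const_sub 1
    refine (((hx.pow 2).const_mul 1000).div (((hx.const_mul 100).const_sub 317).sub
      ((hx.pow 2).const_mul 35)) hB.ne').congr_deriv ?_
    simp only [Pi.sub_apply, Pi.pow_apply]
    congr 1
    push_cast
    ring
  · rw [unitWeight_of_nonpos (by linarith), unitReaction_of_nonpos (by linarith)]
    obtain ⟨t, rfl⟩ : ∃ t, s = -(9 / 10 * t) := ⟨-s * 10 / 9, by ring⟩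
    have ht : 0 ≤ t := by linarith
    have ht' : 0 ≤ 1 - t := by linarith
    have hcert : 0 ≤ 114170/3 * (1 - t) ^ 6 + 1552732 * t * (1 - t) ^ 5
          + 53931365/8 * t ^ 2 * (1 - t) ^ 4 + 1341430321/120 * t ^ 3 * (1 - t) ^ 3
          + 1292234923/160 * t ^ 4 * (1 - t) ^ 2 + 3436304923/1600 * t ^ 5 * (1 - t)
          + 1276229287/38400 * t ^ 6 := by positivity
    set B := 317 - 100 * (1 - -(9 / 10 * t)) - 35 * (1 - -(9 / 10 * t)) ^ 2 with hBdef
    have key : 5 / 6 * (5 / 2 * (1 - -(9 / 10 * t)))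
        * ((-(9 / 10 * t) + 2) * (1 - -(9 / 10 * t)) ^ 2)
        * (-1000 * (1 - -(9 / 10 * t)) * (634 - 100 * (1 - -(9 / 10 * t))) / B ^ 2 + 3 / 10
          - (-(15 / 2) * (1 - -(9 / 10 * t)) - 4 / 5))
        + (1000 * (1 - -(9 / 10 * t)) ^ 2 / B) ^ 2
        = -((1 + 9 / 10 * t) ^ 3 * (114170/3 * (1 - t) ^ 6 + 1552732 * t * (1 - t) ^ 5
          + 53931365/8 * t ^ 2 * (1 - t) ^ 4 + 1341430321/120 * t ^ 3 * (1 - t) ^ 3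
          + 1292234923/160 * t ^ 4 * (1 - t) ^ 2 + 3436304923/1600 * t ^ 5 * (1 - t)
          + 1276229287/38400 * t ^ 6) / B ^ 2) := by
      field_simp
      rw [hBdef]
      ring
    rw [key, neg_nonpos]
    positivity

/-- The Riccati multiplier on `[0, 1/2]`. -/
lemma riccati_right {s : ℝ} (hs : s ∈ Icc (0 : ℝ) (1 / 2)) :
    HasDerivAt (fun s : ℝ => 109 / 20 - 19 * s - 2 * s ^ 2 + 66 * s ^ 3 - 59 * s ^ 4)
      (-19 - 4 * s + 198 * s ^ 2 - 236 * s ^ 3) s ∧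
    5 / 6 * unitWeight s * ((s + 2) * (1 - s) ^ 2)
      * (-19 - 4 * s + 198 * s ^ 2 - 236 * s ^ 3 + 5 / 2 - unitReaction s)
      + (109 / 20 - 19 * s - 2 * s ^ 2 + 66 * s ^ 3 - 59 * s ^ 4) ^ 2 ≤ 0 := by
  obtain ⟨h1, h2⟩ := hs
  constructor
  · have hx := hasDerivAt_id s
    refine (((((hx.const_mul 19).const_sub (109 / 20)).sub ((hx.pow 2).const_mul 2)).add
      ((hx.pow 3).const_mul 66)).sub ((hx.pow 4).const_mul 59)).congr_deriv ?_
    simp only [id]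
    push_cast
    ring
  · rw [unitWeight_of_nonneg h1, unitReaction_of_nonneg h1]
    obtain ⟨t, rfl⟩ : ∃ t, s = t / 2 := ⟨2 * s, by ring⟩
    have ht : 0 ≤ t := by linarith
    have ht' : 0 ≤ 1 - t := by linarith
    have hcert : 0 ≤ 5357/1200 * (1 - t) ^ 12 + 1337/100 * t * (1 - t) ^ 11
          + 31199/2400 * t ^ 2 * (1 - t) ^ 10 + 88819/960 * t ^ 3 * (1 - t) ^ 9
          + 805427/1920 * t ^ 4 * (1 - t) ^ 8 + 15661429/19200 * t ^ 5 * (1 - t) ^ 7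
          + 5418101/6400 * t ^ 6 * (1 - t) ^ 6 + 4911107/9600 * t ^ 7 * (1 - t) ^ 5
          + 1424527/7680 * t ^ 8 * (1 - t) ^ 4 + 681241/15360 * t ^ 9 * (1 - t) ^ 3
          + 281081/25600 * t ^ 10 * (1 - t) ^ 2 + 84257/25600 * t ^ 11 * (1 - t)
          + 25617/51200 * t ^ 12 := by positivity
    nlinarith only [hcert]

lemma hasDerivAt_residual_left {s : ℝ} (hs : s ≤ 0) :
    HasDerivAt (fun s : ℝ => 37 / 5 * s - 19 / 4 * s ^ 2 - 5 / 18 * s ^ 3)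
      (unitReaction s + 2 * (16 / 5) * unitWeight s
        - (unitReaction s + 16 / 5 * unitWeight s) ^ 2 / (3 / 10)) s := by
  rw [unitWeight_of_nonpos hs, unitReaction_of_nonpos hs]
  have hx := hasDerivAt_id s
  refine (((hx.const_mul (37 / 5)).sub ((hx.pow 2).const_mul (19 / 4))).sub
    ((hx.pow 3).const_mul (5 / 18))).congr_deriv ?_
  simp only [id]
  push_cast
  ring

lemma hasDerivAt_residual_right {s : ℝ} (hs : 0 ≤ s) :
    HasDerivAt (fun s : ℝ => 958 / 125 * s - 4151 / 100 * s ^ 2 - 10921 / 30 * s ^ 3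
        + 88873 / 25 * s ^ 4 - 1228862 / 125 * s ^ 5 + 146503 / 15 * s ^ 6 + 39052 / 35 * s ^ 7
        - 38848 / 5 * s ^ 8 + 131032 / 45 * s ^ 9 + 1464 * s ^ 10 - 9000 / 11 * s ^ 11)
      (unitReaction s + 2 * (16 / 5) * unitWeight s
        - (unitReaction s + 16 / 5 * unitWeight s) ^ 2 / (5 / 2)) s := by
  rw [unitWeight_of_nonneg hs, unitReaction_of_nonneg hs]
  have hx := hasDerivAt_id s
  refine (((((((((((hx.const_mul (958 / 125)).sub ((hx.pow 2).const_mul (4151 / 100))).sub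
    ((hx.pow 3).const_mul (10921 / 30))).add ((hx.pow 4).const_mul (88873 / 25))).sub
    ((hx.pow 5).const_mul (1228862 / 125))).add ((hx.pow 6).const_mul (146503 / 15))).add
    ((hx.pow 7).const_mul (39052 / 35))).sub ((hx.pow 8).const_mul (38848 / 5))).add
    ((hx.pow 9).const_mul (131032 / 45))).add ((hx.pow 10).const_mul 1464)).sub
    ((hx.pow 11).const_mul (9000 / 11))).congr_deriv ?_
  simp only [id]
  push_cast
  ring

lemma integrable_comp_mul {v g f : ℝ → ℝ} {a b : ℝ} {m : Measure ℝ} (hv : Continuous v)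
    (hv1 : ∀ ξ, v ξ ∈ Ioo a b) (hg : Continuous g) (hf : Integrable f m) :
    Integrable (fun ξ => g (v ξ) * f ξ) m := by
  obtain ⟨C, hC⟩ := isCompact_Icc.exists_bound_of_continuousOn (hg.continuousOn (s := Icc a b))
  exact hf.bdd_mul (hg.comp hv).aestronglyMeasurable
    (ae_of_all _ fun ξ => hC _ (Ioo_subset_Icc_self (hv1 ξ)))

lemma integrableOn_deriv_of_bounded {v : ℝ → ℝ} {a b : ℝ} (hv : ContDiff ℝ 1 v)
    (hv1 : ∀ ξ, v ξ ∈ Ioo a b) (hpos : ∀ ξ, 0 ≤ deriv v ξ) (c : ℝ) :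
    IntegrableOn (deriv v) (Iic c) := by
  have hc := hv.continuous_deriv le_rfl
  refine integrableOn_Iic_of_intervalIntegral_norm_bounded (b - a) c (l := atBot)
    (a := fun x => x) (fun x => hc.integrableOn_Ioc) tendsto_id ?_
  refine Eventually.of_forall fun x => ?_
  simp only [Real.norm_eq_abs, abs_of_nonneg (hpos _)]
  rw [intervalIntegral.integral_deriv_eq_sub
    (fun y _ => hv.differentiable one_ne_zero y) (hc.intervalIntegrable _ _)]
  linarith [(hv1 c).2, (hv1 x).1]

/-- The estimate for `u_m = 1`. -/
lemma unit_energy_nonneg {ν : ℝ} (hν : 0 < ν) {v φ : ℝ → ℝ} (hv : ContDiff ℝ 1 v)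
    (hφ : ContDiff ℝ 1 φ) (hv1 : ∀ ξ, v ξ ∈ Ioo (-2) 1)
    (hode : ∀ ξ, deriv v ξ = (v ξ + 2) * (1 - v ξ) ^ 2 / ν)
    (hbot : Tendsto v atBot (𝓝 (-2))) {c : ℝ} (hc : v c = 1 / 2)
    (hφ2 : Integrable (fun ξ => φ ξ ^ 2)) (hφ'2 : Integrable (fun ξ => deriv φ ξ ^ 2)) :
    0 ≤ 5 / 6 * (∫ ξ in Iic c, ν * unitWeight (v ξ) * deriv φ ξ ^ 2)
      + (∫ ξ in Iic c, φ ξ ^ 2 * deriv v ξ * unitReaction (v ξ))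
      + 8 / 25 * (∫ ξ in Iic c, φ ξ * unitWeight (v ξ) * deriv v ξ) ^ 2 := by
  have hcv := hv.continuous
  have hcφ := hφ.continuous
  have hcv' := hv.continuous_deriv le_rfl
  have hpos : ∀ ξ, 0 < deriv v ξ := fun ξ => by
    have h1 : 0 < v ξ + 2 := by linarith [(hv1 ξ).1]
    have h2 : 0 < 1 - v ξ := by linarith [(hv1 ξ).2]
    rw [hode]; positivity
  have hmono : StrictMono v := strictMono_of_deriv_pos hpos
  have hsurj : ∀ s : ℝ, -2 < s → s ≤ 1 / 2 → ∃ ξ ≤ c, v ξ = s := by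
    intro s hs hs'
    obtain ⟨x, hx⟩ := (hbot.eventually (gt_mem_nhds hs)).exists
    obtain ⟨ξ, hξ⟩ := mem_range_of_exists_le_of_exists_ge hcv ⟨x, hx.le⟩ ⟨c, hc ▸ hs'⟩
    exact ⟨ξ, hmono.le_iff_le.1 (by linarith), hξ⟩
  obtain ⟨z, hzc, hz⟩ := hsurj 0 (by norm_num) (by norm_num)
  obtain ⟨y, -, hy⟩ := hsurj (-9 / 10) (by norm_num) (by norm_num)
  have hyz : y ≤ z := hmono.le_iff_le.1 (by linarith)
  set A := φ y with hA
  have hi1 : IntegrableOn (fun ξ => ν * unitWeight (v ξ) * deriv φ ξ ^ 2) (Iic c) :=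
    integrable_comp_mul (g := fun s => ν * unitWeight s) hcv hv1
      (continuous_const.mul continuous_unitWeight) hφ'2.integrableOn
  have hi2 : IntegrableOn (fun ξ => φ ξ ^ 2 * deriv v ξ * unitReaction (v ξ)) (Iic c) := by
    refine (integrable_comp_mul (g := fun s => (s + 2) * (1 - s) ^ 2 / ν * unitReaction s) hcv hv1
      (.mul (by fun_prop) continuous_unitReaction) hφ2.integrableOn).congr
      (ae_of_all _ fun ξ => ?_)
    simp only [hode]; ring
  have hv'int := integrableOn_deriv_of_bounded hv hv1 (fun ξ => (hpos ξ).le) c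
  have hv'2 : IntegrableOn (fun ξ => deriv v ξ ^ 2) (Iic c) := by
    refine (integrable_comp_mul (g := fun s => (s + 2) * (1 - s) ^ 2 / ν) hcv hv1
      (by fun_prop) hv'int).congr (ae_of_all _ fun ξ => ?_)
    simp only [hode]; ring
  have hφv' : IntegrableOn (fun ξ => φ ξ * deriv v ξ) (Iic c) := by
    refine Integrable.mono' (hφ2.integrableOn.add hv'2)
      (hcφ.mul hcv').aestronglyMeasurable (ae_of_all _ fun ξ => ?_)
    rw [Real.norm_eq_abs, Pi.add_apply, abs_le]
    constructor <;> nlinarith [sq_nonneg (φ ξ + deriv v ξ), sq_nonneg (φ ξ - deriv v ξ)]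
  have hi3 : IntegrableOn (fun ξ => φ ξ * unitWeight (v ξ) * deriv v ξ) (Iic c) := by
    refine (integrable_comp_mul hcv hv1 continuous_unitWeight hφv').congr
      (ae_of_all _ fun ξ => ?_)
    ring
  set G : ℝ → ℝ := fun ξ => 5 / 6 * (ν * unitWeight (v ξ) * deriv φ ξ ^ 2)
    + φ ξ ^ 2 * deriv v ξ * unitReaction (v ξ)
    + 2 * (16 / 5) * A * (φ ξ * unitWeight (v ξ) * deriv v ξ) with hG
  have hGi : IntegrableOn G (Iic c) := ((hi1.const_mul _).add hi2).add (hi3.const_mul _)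
  have hGint : ∫ ξ in Iic c, G ξ = 5 / 6 * (∫ ξ in Iic c, ν * unitWeight (v ξ) * deriv φ ξ ^ 2)
      + (∫ ξ in Iic c, φ ξ ^ 2 * deriv v ξ * unitReaction (v ξ))
      + 2 * (16 / 5) * A * ∫ ξ in Iic c, φ ξ * unitWeight (v ξ) * deriv v ξ := by
    rw [← integral_const_mul, ← integral_const_mul, ← integral_add (hi1.const_mul _) hi2]
    exact integral_add ((hi1.const_mul _).add hi2) (hi3.const_mul _)
  have hGloc : ∀ p q, p ≤ q → q ≤ c → IntervalIntegrable G volume p q := fun p q hpq hq =>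
    (intervalIntegrable_iff_integrableOn_Ioc_of_le hpq).2
      (hGi.mono_set fun x hx => hx.2.trans hq)
  have hlow : ∀ᶠ x in atBot,
      (19 / 45 - (37 / 5 * v x - 19 / 4 * v x ^ 2 - 5 / 18 * v x ^ 3)) * A ^ 2
        ≤ ∫ ξ in x..c, G ξ := by
    filter_upwards [eventually_le_atBot y] with x hx
    have hL := riccati_segment (M := 16 / 5) (A := A) hν hv hφ hv1 hode
      (by norm_num : (0 : ℝ) < 3 / 10) hx
      (fun ξ hξ => ⟨(hv1 ξ).1.le, hy ▸ hmono.monotone hξ.2⟩)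
      (fun s hs => (riccati_left hs).1) (fun s hs => hasDerivAt_residual_left (by linarith [hs.2]))
      (fun s hs => (riccati_left hs).2)
    have hM := riccati_segment (M := 16 / 5) (A := A) hν hv hφ hv1 hode
      (by norm_num : (0 : ℝ) < 3 / 10) hyz
      (fun ξ hξ => ⟨hy ▸ hmono.monotone hξ.1, hz ▸ hmono.monotone hξ.2⟩)
      (fun s hs => (riccati_middle hs).1) (fun s hs => hasDerivAt_residual_left hs.2)
      (fun s hs => (riccati_middle hs).2)
    have hR := riccati_segment (M := 16 / 5) (A := A) hν hv hφ hv1 hode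
      (by norm_num : (0 : ℝ) < 5 / 2) hzc
      (fun ξ hξ => ⟨hz ▸ hmono.monotone hξ.1, hc ▸ hmono.monotone hξ.2⟩)
      (fun s hs => (riccati_right hs).1) (fun s hs => hasDerivAt_residual_right hs.1)
      (fun s hs => (riccati_right hs).2)
    have hvx : v x ≤ -9 / 10 := hy ▸ hmono.monotone hx
    have hk : -500 * (v x + 2) / (17 + 7 * (v x + 2) - 20 * (v x + 2) ^ 2)
        * (φ x - A) ^ 2 ≤ 0 := by
      have h2 : 0 < v x + 2 := by linarith [(hv1 x).1]
      have h3 : 0 < 17 + 7 * (v x + 2) - 20 * (v x + 2) ^ 2 := by nlinarith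
      exact mul_nonpos_of_nonpos_of_nonneg (div_nonpos_of_nonpos_of_nonneg (by linarith) h3.le)
        (sq_nonneg _)
    have hsplit : ∫ ξ in x..c, G ξ = (∫ ξ in x..y, G ξ) + (∫ ξ in y..z, G ξ)
        + ∫ ξ in z..c, G ξ := by
      rw [intervalIntegral.integral_add_adjacent_intervals (hGloc _ _ hx (hyz.trans hzc))
        (hGloc _ _ hyz hzc), intervalIntegral.integral_add_adjacent_intervals
        (hGloc _ _ (hx.trans hyz) hzc) (hGloc _ _ hzc le_rfl)]
    rw [hsplit]
    simp only [← hA, hy, hz, hc, sub_self] at hL hM hR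
    change _ ≤ ∫ ξ in x..y, G ξ at hL
    change _ ≤ ∫ ξ in y..z, G ξ at hM
    change _ ≤ ∫ ξ in z..c, G ξ at hR
    nlinarith [sq_nonneg (φ z - A), sq_nonneg (φ c - A), sq_nonneg A]
  have hlim := intervalIntegral_tendsto_integral_Iic c hGi tendsto_id
  have hvlim : Tendsto (fun x => (19 / 45 - (37 / 5 * v x - 19 / 4 * v x ^ 2
      - 5 / 18 * v x ^ 3)) * A ^ 2) atBot (𝓝 (32 * A ^ 2)) := by
    have hcont : Continuous fun s : ℝ => (19 / 45 - (37 / 5 * s - 19 / 4 * s ^ 2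
        - 5 / 18 * s ^ 3)) * A ^ 2 := by
      fun_prop
    have := (hcont.tendsto (-2)).comp hbot
    refine this.trans_eq ?_
    norm_num
  have hfin := le_of_tendsto_of_tendsto hvlim hlim hlow
  rw [hGint] at hfin
  nlinarith [sq_nonneg ((∫ ξ in Iic c, φ ξ * unitWeight (v ξ) * deriv v ξ) - 10 * A)]

lemma deriv_and_deriv_deriv_of_eventuallyEq {w f f' : ℝ → ℝ} {f'' s : ℝ} (h : w =ᶠ[𝓝 s] f)
    (hf : ∀ x, HasDerivAt f (f' x) x) (hf' : HasDerivAt f' f'' s) :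
    deriv w s = f' s ∧ deriv (deriv w) s = f'' := by
  have hd : deriv w =ᶠ[𝓝 s] f' := h.deriv.trans (.of_eq (funext fun x => (hf x).deriv))
  exact ⟨hd.eq_of_nhds, hd.deriv_eq.trans hf'.deriv⟩

/-- The weight and its first two derivatives in the variable `s / u_m`. -/
lemma weight_rescale {w : ℝ → ℝ} {um s : ℝ} (hum : 0 < um)
    (hw : ∀ s, w s = if s < 0 then (5 / 2) * um * (um - s)
        else if s < um / 2 then (5 / (2 * um ^ 2)) * (um - s) * (4 * s ^ 3 + um ^ 3)
        else (15 / 8) * um ^ 2)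
    (hs : s < um / 2) :
    w s = um ^ 2 * unitWeight (s / um) ∧
      (s ≠ 0 →
        deriv w s = um * (5 / 2 * (-1 + 12 * max (s / um) 0 ^ 2 - 16 * max (s / um) 0 ^ 3)) ∧
        deriv (deriv w) s = 5 / 2 * (24 * max (s / um) 0 - 48 * max (s / um) 0 ^ 2)) := by
  constructor
  · rw [hw]
    split_ifs with h
    · rw [unitWeight_of_nonpos (div_nonpos_of_nonpos_of_nonneg h.le hum.le)]
      field_simp
    · rw [unitWeight_of_nonneg (div_nonneg (not_lt.1 h) hum.le)]
      field_simp
      ring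
  · intro h0
    rcases lt_or_gt_of_ne h0 with h | h
    · have he : w =ᶠ[𝓝 s] fun s => 5 / 2 * um * (um - s) := by
        filter_upwards [gt_mem_nhds h] with x hx
        rw [hw, if_pos hx]
      have hd : ∀ x, HasDerivAt (fun s => 5 / 2 * um * (um - s)) (-(5 / 2 * um)) x := fun x =>
        (((hasDerivAt_id x).const_sub um).const_mul (5 / 2 * um)).congr_deriv (by ring)
      obtain ⟨h1, h2⟩ := deriv_and_deriv_deriv_of_eventuallyEq he hd (hasDerivAt_const s _)
      rw [h1, h2, max_eq_right (div_nonpos_of_nonpos_of_nonneg h.le hum.le)]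
      constructor <;> ring
    · have he : w =ᶠ[𝓝 s] fun s => 5 / (2 * um ^ 2) * (um - s) * (4 * s ^ 3 + um ^ 3) := by
        filter_upwards [lt_mem_nhds h, gt_mem_nhds hs] with x hx hx'
        rw [hw, if_neg (not_lt.2 (le_of_lt hx)), if_pos hx']
      have hcube : ∀ x : ℝ, HasDerivAt (fun s : ℝ => s ^ 3) (3 * x ^ 2) x := fun x => by
        simpa using hasDerivAt_pow 3 x
      have hsq : HasDerivAt (fun s : ℝ => s ^ 2) (2 * s) s := by simpa using hasDerivAt_pow 2 s
      have hd : ∀ x, HasDerivAt (fun s => 5 / (2 * um ^ 2) * (um - s) * (4 * s ^ 3 + um ^ 3))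
          (5 / (2 * um ^ 2) * (12 * um * x ^ 2 - 16 * x ^ 3 - um ^ 3)) x := fun x =>
        ((((hasDerivAt_id x).const_sub um).const_mul (5 / (2 * um ^ 2))).mul
          (((hcube x).const_mul 4).add_const (um ^ 3))).congr_deriv (by simp only [id]; ring)
      have hd' : HasDerivAt
          (fun x => 5 / (2 * um ^ 2) * (12 * um * x ^ 2 - 16 * x ^ 3 - um ^ 3))
          (5 / (2 * um ^ 2) * (24 * um * s - 48 * s ^ 2)) s :=
        ((((hsq.const_mul (12 * um)).sub ((hcube s).const_mul 16)).sub_const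
          (um ^ 3)).const_mul _).congr_deriv (by ring)
      obtain ⟨h1, h2⟩ := deriv_and_deriv_deriv_of_eventuallyEq he hd hd'
      rw [h1, h2, max_eq_left (div_nonneg h.le hum.le)]
      constructor
      · field_simp
        ring
      · field_simp

/-- a-contraction estimate on the compressive part of the shock (Lemma 4.3). -/
theorem a_contraction_compressive
    (μ uminus um σ : ℝ) (hμ : 0 < μ) (huminus : uminus < 0)
    (hum : um = -uminus / 2) (hσ : σ = 3 * um ^ 2)
    (uS : ℝ → ℝ) (huS : ContDiff ℝ 1 uS)
    (hrange : ∀ ξ, uS ξ ∈ Set.Ioo uminus um)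
    (hODE : ∀ ξ, μ * deriv uS ξ = (uS ξ - uminus) * (uS ξ - um) ^ 2)
    (hbot : Tendsto uS atBot (nhds uminus))
    (htop : Tendsto uS atTop (nhds um))
    (w : ℝ → ℝ)
    (hw : ∀ s, w s = if s < 0 then (5 / 2) * um * (um - s)
        else if s < um / 2 then (5 / (2 * um ^ 2)) * (um - s) * (4 * s ^ 3 + um ^ 3)
        else (15 / 8) * um ^ 2)
    (ξs : ℝ) (hξs : uS ξs = um / 2)
    (φ : ℝ → ℝ) (hφ : ContDiff ℝ 1 φ)
    (hφ2 : Integrable (fun ξ => (φ ξ) ^ 2))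
    (hφ'2 : Integrable (fun ξ => (deriv φ ξ) ^ 2)) :
    (1 / 6) * (∫ ξ in Set.Iio ξs, μ * w (uS ξ) * (deriv φ ξ) ^ 2)
      + (4 / 5) * um ^ 3 * (∫ ξ in Set.Iio ξs, (φ ξ) ^ 2 * deriv uS ξ)
    ≤ (∫ ξ in Set.Iio ξs, μ * w (uS ξ) * (deriv φ ξ) ^ 2)
      + (∫ ξ in Set.Iio ξs, (φ ξ) ^ 2 * deriv uS ξ *
          (σ * deriv w (uS ξ) - 3 * (uS ξ) ^ 2 * deriv w (uS ξ)
            + 3 * uS ξ * w (uS ξ) - (deriv (deriv w) (uS ξ) / 2) * μ * deriv uS ξ))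
      + (8 / (25 * um ^ 2)) * (∫ ξ in Set.Iio ξs, φ ξ * w (uS ξ) * deriv uS ξ) ^ 2 := by
  have hum0 : 0 < um := by linarith
  obtain rfl : uminus = -2 * um := by linarith
  subst hσ
  set v : ℝ → ℝ := fun ξ => uS ξ / um with hvdef
  have hvC : ContDiff ℝ 1 v := huS.div_const um
  have hv1 : ∀ ξ, v ξ ∈ Set.Ioo (-2) 1 := fun ξ =>
    ⟨(lt_div_iff₀ hum0).2 (hrange ξ).1, (div_lt_one hum0).2 (hrange ξ).2⟩
  have hv' : ∀ ξ, deriv uS ξ = um * deriv v ξ := fun ξ => by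
    rw [hvdef, deriv_div_const]; field_simp
  have hu : ∀ ξ, uS ξ = um * v ξ := fun ξ => by rw [hvdef]; field_simp
  have hν : 0 < μ / um ^ 2 := by positivity
  have hode : ∀ ξ, deriv v ξ = (v ξ + 2) * (1 - v ξ) ^ 2 / (μ / um ^ 2) := fun ξ => by
    have h := hODE ξ
    rw [hv', hu] at h
    field_simp
    refine mul_left_cancel₀ hum0.ne' ?_
    linear_combination h
  have hpos : ∀ ξ, 0 < deriv uS ξ := fun ξ => by
    have h1 := sub_pos.2 (hrange ξ).1
    have h2 := pow_pos (sub_pos.2 (hrange ξ).2) 2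
    refine pos_of_mul_pos_right (a := μ) ?_ hμ.le
    rw [hODE, ← neg_sub um, neg_sq]
    exact mul_pos h1 h2
  have hmono : StrictMono uS := strictMono_of_deriv_pos hpos
  have hlt : ∀ ξ ∈ Set.Iio ξs, uS ξ < um / 2 := fun ξ hξ => hξs ▸ hmono hξ
  have hvbot : Tendsto v atBot (𝓝 (-2)) :=
    (hbot.div_const um).trans_eq (by rw [mul_div_cancel_right₀ _ hum0.ne'])
  have hc : v ξs = 1 / 2 := by rw [hvdef]; simp only [hξs]; field_simp
  have hmain := unit_energy_nonneg hν hvC hφ hv1 hode hvbot hc hφ2 hφ'2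
  simp only [integral_Iic_eq_integral_Iio] at hmain
  have hJ1 : ∫ ξ in Set.Iio ξs, μ * w (uS ξ) * deriv φ ξ ^ 2
      = um ^ 4 * ∫ ξ in Set.Iio ξs, μ / um ^ 2 * unitWeight (v ξ) * deriv φ ξ ^ 2 := by
    rw [← integral_const_mul]
    refine setIntegral_congr_fun measurableSet_Iio fun ξ hξ => ?_
    simp only [(weight_rescale hum0 hw (hlt ξ hξ)).1, hvdef]
    field_simp
  have hJ3 : ∫ ξ in Set.Iio ξs, φ ξ * w (uS ξ) * deriv uS ξ
      = um ^ 3 * ∫ ξ in Set.Iio ξs, φ ξ * unitWeight (v ξ) * deriv v ξ := by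
    rw [← integral_const_mul]
    refine setIntegral_congr_fun measurableSet_Iio fun ξ hξ => ?_
    simp only [(weight_rescale hum0 hw (hlt ξ hξ)).1, hv', hvdef]
    ring
  have hcv := hvC.continuous
  have hi0 : IntegrableOn (fun ξ => φ ξ ^ 2 * deriv v ξ) (Set.Iio ξs) := by
    refine (integrable_comp_mul (g := fun s => (s + 2) * (1 - s) ^ 2 / (μ / um ^ 2)) hcv hv1
      (by fun_prop) hφ2.integrableOn).congr (ae_of_all _ fun ξ => ?_)
    simp only [hode]; ring
  have hi2 : IntegrableOn (fun ξ => φ ξ ^ 2 * deriv v ξ * unitReaction (v ξ)) (Set.Iio ξs) :=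
    (integrable_comp_mul hcv hv1 continuous_unitReaction hi0).congr
      (ae_of_all _ fun ξ => mul_comm _ _)
  have hJ0 : ∫ ξ in Set.Iio ξs, φ ξ ^ 2 * deriv uS ξ
      = um * ∫ ξ in Set.Iio ξs, φ ξ ^ 2 * deriv v ξ := by
    rw [← integral_const_mul]
    refine setIntegral_congr_fun measurableSet_Iio fun ξ _ => ?_
    simp only [hv']
    ring
  have hne : ∀ᵐ ξ, uS ξ ≠ 0 := by
    have : {ξ | uS ξ = 0}.Subsingleton := fun x hx y hy => hmono.injective (hx.trans hy.symm)
    simpa [ae_iff] using this.measure_zero volume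
  have hJ2 : ∫ ξ in Set.Iio ξs, (φ ξ) ^ 2 * deriv uS ξ *
          (3 * um ^ 2 * deriv w (uS ξ) - 3 * (uS ξ) ^ 2 * deriv w (uS ξ)
            + 3 * uS ξ * w (uS ξ) - (deriv (deriv w) (uS ξ) / 2) * μ * deriv uS ξ)
      = um ^ 4 * ((∫ ξ in Set.Iio ξs, φ ξ ^ 2 * deriv v ξ * unitReaction (v ξ))
        + 4 / 5 * ∫ ξ in Set.Iio ξs, φ ξ ^ 2 * deriv v ξ) := by
    rw [← integral_const_mul, ← integral_add hi2 (hi0.const_mul _), ← integral_const_mul]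
    refine setIntegral_congr_ae measurableSet_Iio ?_
    filter_upwards [hne] with ξ h0 hξ
    obtain ⟨e0, e⟩ := weight_rescale hum0 hw (hlt ξ hξ)
    obtain ⟨e1, e2⟩ := e h0
    have e3 : uS ξ / um = v ξ := rfl
    rw [e0, e1, e2, mul_assoc _ μ, hODE, e3, hu, hv', unitReaction, unitWeight]
    ring
  rw [hJ1, hJ2, hJ3, hJ0]
  have h8 : 8 / (25 * um ^ 2) * (um ^ 3 * ∫ ξ in Set.Iio ξs, φ ξ * unitWeight (v ξ) * deriv v ξ) ^ 2
      = um ^ 4 * (8 / 25 * (∫ ξ in Set.Iio ξs, φ ξ * unitWeight (v ξ) * deriv v ξ) ^ 2) := by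
    field_simp
  rw [h8]
  have := mul_nonneg (pow_nonneg hum0.le 4) hmain
  linarith
end

section
/- Full shock functional estimate (Lemma 4.5): Let φ : ℝ → ℝ be continuously differentiable with φ and φ′ square-integrable and φ⁴(u^S)′ integrable, and set Ẋ := (32/(25u_m²)) ∫_ℝ φ w(u^S) (u^S)′ dξ. Then G^S := ∫_ℝ μ w(u^S) (φ′)² dξ + ∫_ℝ φ² (u^S)′ [σ w′(u^S) − 3(u^S)² w′(u^S) + 3 u^S w(u^S) − (w″(u^S)/2) μ (u^S)′] dξ + Ẋ ∫_ℝ φ w(u^S) (u^S)′ dξ − (3/4) ∫_ℝ φ⁴ w′(u^S) (u^S)′ dξ satisfies G^S ≥ (5/16) u_m² ∫_ℝ μ (φ′)² dξ + (4/5) u_m³ ∫_ℝ φ² (u^S)′ dξ + (25/64) u_m² Ẋ² + (3/4) ∫_ℝ φ⁴ |w′(u^S)| (u^S)′ dξ. -/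
open MeasureTheory Filter

namespace ShockEstimate

/-- Gluing two differentiable functions whose values and derivatives agree at `a`. -/
theorem hasDerivAt_ite_lt {f g f' g' : ℝ → ℝ} {a : ℝ}
    (hf : ∀ x, HasDerivAt f (f' x) x) (hg : ∀ x, HasDerivAt g (g' x) x)
    (h : f a = g a) (h' : f' a = g' a) (x : ℝ) :
    HasDerivAt (fun y => if y < a then f y else g y) (if x < a then f' x else g' x) x := by
  rcases lt_trichotomy x a with hx | rfl | hx
  · rw [if_pos hx]
    refine (hf x).congr_of_eventuallyEq ?_
    filter_upwards [gt_mem_nhds hx] with y hy using if_pos hy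
  · rw [if_neg (lt_irrefl x), ← hasDerivWithinAt_univ, ← Set.Iic_union_Ici (a := x)]
    refine HasDerivWithinAt.union ?_ ?_
    · rw [← h']
      refine (hf x).hasDerivWithinAt.congr (fun y hy => ?_) (by simp [h])
      rcases (Set.mem_Iic.1 hy).lt_or_eq with hy | rfl
      · exact if_pos hy
      · simp [h]
    · exact (hg x).hasDerivWithinAt.congr (fun y hy => if_neg (not_lt.2 hy)) (by simp)
  · rw [if_neg hx.not_gt]
    refine (hg x).congr_of_eventuallyEq ?_
    filter_upwards [lt_mem_nhds hx] with y hy using if_neg hy.not_gt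

/-- The weight function normalised to `u_m = 1`. -/
noncomputable def weight (u : ℝ) : ℝ :=
  if u < 0 then 5 / 2 * (1 - u)
  else if u < 1 / 2 then 5 / 2 * (1 - u) * (4 * u ^ 3 + 1) else 15 / 8

/-- The first derivative of `weight`. -/
noncomputable def weightDeriv (u : ℝ) : ℝ :=
  if u < 0 then -(5 / 2)
  else if u < 1 / 2 then 5 / 2 * (-1 + 12 * u ^ 2 - 16 * u ^ 3) else 0

/-- The second derivative of `weight`. -/
noncomputable def weightDeriv₂ (u : ℝ) : ℝ :=
  if u < 0 then 0
  else if u < 1 / 2 then 5 / 2 * (24 * u - 48 * u ^ 2) else 0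

theorem hasDerivAt_weight (u : ℝ) : HasDerivAt weight (weightDeriv u) u := by
  refine hasDerivAt_ite_lt (f := fun y => 5 / 2 * (1 - y)) (f' := fun _ => -(5 / 2))
    (fun y => ?_) (hasDerivAt_ite_lt (f := fun y => 5 / 2 * (1 - y) * (4 * y ^ 3 + 1))
      (f' := fun y => 5 / 2 * (-1 + 12 * y ^ 2 - 16 * y ^ 3)) (fun y => ?_)
      (fun y => hasDerivAt_const y _) ?_ ?_) ?_ ?_ u
  · exact (((hasDerivAt_id' y).const_sub 1).const_mul (5 / 2)).congr_deriv (by ring)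
  · exact ((((hasDerivAt_id' y).const_sub 1).const_mul (5 / 2)).mul
      (((hasDerivAt_pow 3 y).const_mul 4).add_const 1)).congr_deriv (by norm_num; ring)
  all_goals norm_num

theorem hasDerivAt_weightDeriv (u : ℝ) : HasDerivAt weightDeriv (weightDeriv₂ u) u := by
  refine hasDerivAt_ite_lt (f' := fun _ => 0) (fun y => hasDerivAt_const y _)
    (hasDerivAt_ite_lt (f := fun y => 5 / 2 * (-1 + 12 * y ^ 2 - 16 * y ^ 3))
      (f' := fun y => 5 / 2 * (24 * y - 48 * y ^ 2)) (fun y => ?_)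
      (fun y => hasDerivAt_const y _) ?_ ?_) ?_ ?_ u
  · exact ((((hasDerivAt_pow 2 y).const_mul 12).const_add (-1)).sub
      ((hasDerivAt_pow 3 y).const_mul 16)).const_mul (5 / 2) |>.congr_deriv (by norm_num; ring)
  all_goals norm_num

theorem continuous_weight : Continuous weight :=
  continuous_iff_continuousAt.2 fun u => (hasDerivAt_weight u).continuousAt

theorem measurable_weightDeriv : Measurable weightDeriv := by
  rw [← funext fun u => (hasDerivAt_weight u).deriv]
  exact measurable_deriv _

theorem measurable_weightDeriv₂ : Measurable weightDeriv₂ := by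
  rw [← funext fun u => (hasDerivAt_weightDeriv u).deriv]
  exact measurable_deriv _

theorem weightDeriv_nonpos (u : ℝ) : weightDeriv u ≤ 0 := by
  unfold weightDeriv
  split_ifs with h₀ h₁
  · norm_num
  · nlinarith [mul_nonneg (sq_nonneg (1 - 2 * u)) (by linarith : (0 : ℝ) ≤ 1 + 4 * u)]
  · exact le_rfl

/-- The zeroth-order coefficient of the normalised quadratic functional. -/
noncomputable def coeff (u : ℝ) : ℝ :=
  3 * (1 - u ^ 2) * weightDeriv u + 3 * u * weight u
    - weightDeriv₂ u / 2 * ((u + 2) * (1 - u) ^ 2)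

theorem measurable_coeff : Measurable coeff := by
  have h₀ := continuous_weight.measurable
  have h₁ := measurable_weightDeriv
  have h₂ := measurable_weightDeriv₂
  unfold coeff
  fun_prop

theorem weight_of_neg {u : ℝ} (h : u < 0) : weight u = 5 / 2 * (1 - u) := if_pos h

theorem weight_of_mem_Ico {u : ℝ} (h₀ : 0 ≤ u) (h₁ : u < 1 / 2) :
    weight u = 5 / 2 * (1 - u) * (4 * u ^ 3 + 1) := by
  rw [weight, if_neg h₀.not_gt, if_pos h₁]

theorem weight_of_half_le {u : ℝ} (h : 1 / 2 ≤ u) : weight u = 15 / 8 := by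
  rw [weight, if_neg (by linarith), if_neg h.not_gt]

theorem coeff_of_neg {u : ℝ} (h : u < 0) : coeff u = -(15 / 2) * (1 - u) := by
  simp only [coeff, weight, weightDeriv, weightDeriv₂, if_pos h]
  ring

theorem coeff_of_mem_Ico {u : ℝ} (h₀ : 0 ≤ u) (h₁ : u < 1 / 2) :
    coeff u = -(15 / 2) - 105 / 2 * u + 300 * u ^ 2 - 300 * u ^ 3 - 90 * u ^ 4 + 150 * u ^ 5 := by
  simp only [coeff, weight, weightDeriv, weightDeriv₂, if_neg h₀.not_gt, if_pos h₁]
  ring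

theorem coeff_of_half_le {u : ℝ} (h : 1 / 2 ≤ u) : coeff u = 45 / 8 * u := by
  have h₀ : ¬ u < 0 := by linarith
  simp only [coeff, weight, weightDeriv, weightDeriv₂, if_neg h₀, if_neg h.not_gt]
  ring

theorem abs_weight_le {u : ℝ} (h₀ : -2 < u) (h₁ : u < 1) : |weight u| ≤ 20 := by
  rcases lt_or_ge u 0 with h | h
  · rw [weight_of_neg h, abs_le]
    constructor <;> linarith
  rcases lt_or_ge u (1 / 2) with h' | h'
  · rw [weight_of_mem_Ico h h', abs_le]
    have h₂ : u ^ 3 ≤ 1 := pow_le_one₀ h h₁.le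
    have h₃ : 0 ≤ u ^ 3 := by positivity
    constructor <;> nlinarith [mul_nonneg h h₃]
  · rw [weight_of_half_le h']
    norm_num

theorem abs_coeff_le {u : ℝ} (h₀ : -2 < u) (h₁ : u < 1) : |coeff u| ≤ 1000 := by
  rcases lt_or_ge u 0 with h | h
  · rw [coeff_of_neg h, abs_le]
    constructor <;> linarith
  rcases lt_or_ge u (1 / 2) with h' | h'
  · rw [coeff_of_mem_Ico h h', abs_le]
    have hpow : ∀ k : ℕ, 0 ≤ u ^ k ∧ u ^ k ≤ 1 := fun k =>
      ⟨by positivity, pow_le_one₀ h h₁.le⟩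
    constructor <;> linarith [(hpow 2).1, (hpow 2).2, (hpow 3).1,
      (hpow 3).2, (hpow 4).1, (hpow 4).2, (hpow 5).1, (hpow 5).2]
  · rw [coeff_of_half_le h', abs_le]
    constructor <;> linarith

theorem quadratic_form_nonneg {A R E m n : ℝ} (hA : 0 < A) (hn : 0 < n)
    (h : R ^ 2 * n ≤ A * (n * E - m ^ 2)) (p z c : ℝ) :
    0 ≤ A * p ^ 2 + 2 * R * z * p + E * z ^ 2 + 2 * m * z * c + n * c ^ 2 := by
  have key : 0 ≤ n * A * (A * p ^ 2 + 2 * R * z * p + E * z ^ 2 + 2 * m * z * c + n * c ^ 2) := by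
    have : n * A * (A * p ^ 2 + 2 * R * z * p + E * z ^ 2 + 2 * m * z * c + n * c ^ 2)
        = n * (A * p + R * z) ^ 2 + (A * (n * E - m ^ 2) - R ^ 2 * n) * z ^ 2
          + A * (n * c + m * z) ^ 2 := by ring
    rw [this]
    have := sub_nonneg.2 h
    positivity
  exact nonneg_of_mul_nonneg_right key (by positivity)

/-- The density obtained by adding the linear term `6 c W φ` to the local quadratic functional. -/
noncomputable def density (ν c : ℝ) (x φ : ℝ → ℝ) (ξ : ℝ) : ℝ :=
  ν * (weight (x ξ) - 5 / 16) * deriv φ ξ ^ 2 + (coeff (x ξ) - 4 / 5) * φ ξ ^ 2 * deriv x ξ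
    + 6 * c * weight (x ξ) * φ ξ * deriv x ξ

/-- The pointwise condition on a Riccati multiplier `R` and a potential `T` with `R' = R₁`,
`T' = τ` under which `c ^ 2 * T - R * (φ - c) ^ 2` is a subsolution for `density`. -/
def Admissible (u R R₁ τ : ℝ) : Prop :=
  0 < (weight u - 5 / 16) * ((u + 2) * (1 - u) ^ 2) ∧
  0 < coeff u - 4 / 5 + 6 * weight u - τ ∧
  R ^ 2 * (coeff u - 4 / 5 + 6 * weight u - τ) ≤
    (weight u - 5 / 16) * ((u + 2) * (1 - u) ^ 2) *
      ((coeff u - 4 / 5 + 6 * weight u - τ) * (coeff u - 4 / 5 + R₁)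
        - (coeff u - 4 / 5 + 3 * weight u) ^ 2)

theorem le_density {ν c R R₁ τ : ℝ} {x φ : ℝ → ℝ} {ξ : ℝ}
    (hx' : 0 < deriv x ξ) (hode : ν * deriv x ξ = (x ξ + 2) * (1 - x ξ) ^ 2)
    (h : Admissible (x ξ) R R₁ τ) :
    c ^ 2 * (τ * deriv x ξ)
      - (R₁ * deriv x ξ * (φ ξ - c) ^ 2 + R * (2 * (φ ξ - c) * deriv φ ξ))
      ≤ density ν c x φ ξ := by
  obtain ⟨hA, hn, hR⟩ := h
  have key := mul_nonneg hx'.le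
    (quadratic_form_nonneg hA hn hR (deriv φ ξ / deriv x ξ) (φ ξ - c) c)
  rw [← hode] at key
  have hne := hx'.ne'
  rw [← sub_nonneg, density]
  refine key.trans_eq ?_
  field_simp
  ring

theorem sub_le_integral_density {ν c p q : ℝ} {x φ R R₁ T τ : ℝ → ℝ} (hpq : p ≤ q)
    (hx : Differentiable ℝ x) (hφ : Differentiable ℝ φ)
    (hx' : ∀ ξ, 0 < deriv x ξ) (hode : ∀ ξ, ν * deriv x ξ = (x ξ + 2) * (1 - x ξ) ^ 2)
    (hint : Integrable (density ν c x φ))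
    (hR : ∀ u ∈ Set.Icc (x p) (x q), HasDerivAt R (R₁ u) u)
    (hT : ∀ u ∈ Set.Icc (x p) (x q), HasDerivAt T (τ u) u)
    (h : ∀ u ∈ Set.Ioo (x p) (x q), Admissible u (R u) (R₁ u) (τ u)) :
    (c ^ 2 * T (x q) - R (x q) * (φ q - c) ^ 2) - (c ^ 2 * T (x p) - R (x p) * (φ p - c) ^ 2)
      ≤ ∫ ξ in p..q, density ν c x φ ξ := by
  have hmono : StrictMono x := strictMono_of_deriv_pos hx'
  have hderiv : ∀ ξ ∈ Set.Icc p q,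
      HasDerivAt (fun ξ => c ^ 2 * T (x ξ) - R (x ξ) * (φ ξ - c) ^ 2)
        (c ^ 2 * (τ (x ξ) * deriv x ξ) - (R₁ (x ξ) * deriv x ξ * (φ ξ - c) ^ 2
          + R (x ξ) * (2 * (φ ξ - c) * deriv φ ξ))) ξ := by
    intro ξ hξ
    have hmem : x ξ ∈ Set.Icc (x p) (x q) := ⟨hmono.monotone hξ.1, hmono.monotone hξ.2⟩
    have hxξ := (hx ξ).hasDerivAt
    refine (((hT _ hmem).comp ξ hxξ).const_mul (c ^ 2)).sub
      (((hR _ hmem).comp ξ hxξ).mul ?_)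
    exact (((hφ ξ).hasDerivAt.sub_const c).fun_pow 2).congr_deriv (by norm_num)
  refine intervalIntegral.sub_le_integral_of_hasDeriv_right_of_le hpq
    (fun ξ hξ => (hderiv ξ hξ).continuousAt.continuousWithinAt)
    (fun ξ hξ => (hderiv ξ (Set.Ioo_subset_Icc_self hξ)).hasDerivWithinAt)
    hint.integrableOn fun ξ hξ => ?_
  exact le_density (hx' ξ) (hode ξ) (h _ ⟨hmono hξ.1, hmono hξ.2⟩)

theorem admissible_left {u : ℝ} (h₀ : -2 < u) (h₁ : u < -7 / 10) :
    Admissible u (33 / 20 * ((35 / 16 - 5 / 2 * u) * (u + 2) * (1 - u)) / (-13 / 20 - u))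
      ((33 / 20 * (-(5 / 2) * (u + 2) * (1 - u) + (35 / 16 - 5 / 2 * u) * (-1 - 2 * u)))
          / (-13 / 20 - u)
        + 33 / 20 * ((35 / 16 - 5 / 2 * u) * (u + 2) * (1 - u)) / (-13 / 20 - u) ^ 2)
      (15 / 2 * (1 - u) - 13 / 10) := by
  have hu : u < 0 := by linarith
  have hd : 0 < -13 / 20 - u := by linarith
  have hg : 0 < 35 / 16 - 5 / 2 * u := by linarith
  have hl : 0 < u + 2 := by linarith
  have hr : 0 < 1 - u := by linarith
  have hW : weight u - 5 / 16 = 35 / 16 - 5 / 2 * u := by rw [weight_of_neg hu]; ring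
  have hn : coeff u - 4 / 5 + 6 * weight u - (15 / 2 * (1 - u) - 13 / 10) = 1 / 2 := by
    rw [weight_of_neg hu, coeff_of_neg hu]; ring
  have hm : coeff u - 4 / 5 + 3 * weight u = -(4 / 5) := by
    rw [weight_of_neg hu, coeff_of_neg hu]; ring
  rw [Admissible, hW, hn, hm]
  refine ⟨by positivity, by norm_num, ?_⟩
  rw [coeff_of_neg hu, ← sub_nonneg]
  have hE : 0 ≤ 33 / 20 * (-(45 / 16) - 5 * u) * (1 - u)
      + (15 / 2 * u - 479 / 50) * (-13 / 20 - u) := by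
    nlinarith
  have key : 0 ≤ 1 / 2 * ((35 / 16 - 5 / 2 * u) * ((u + 2) * (1 - u) ^ 2)) *
      ((33 / 20 * (-(45 / 16) - 5 * u) * (1 - u)
      + (15 / 2 * u - 479 / 50) * (-13 / 20 - u)) / (-13 / 20 - u)) := by positivity
  refine key.trans_eq ?_
  generalize hd' : -13 / 20 - u = d at hd ⊢
  obtain rfl : u = -13 / 20 - d := by linarith
  field_simp
  ring

theorem admissible_inner {u : ℝ} (h₀ : -7 / 10 < u) (hu : u < 0) :
    Admissible u (-((35 / 16 - 5 / 2 * u) * ((u + 2) * (1 - u) ^ 2)) / (u + 3 / 4))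
      (-(-(5 / 2) * ((u + 2) * (1 - u) ^ 2) + (35 / 16 - 5 / 2 * u) * (3 * u ^ 2 - 3))
          / (u + 3 / 4)
        + (35 / 16 - 5 / 2 * u) * ((u + 2) * (1 - u) ^ 2) / (u + 3 / 4) ^ 2)
      (15 / 2 * (1 - u) - 13 / 10) := by
  have hd : 0 < u + 3 / 4 := by linarith
  have hg : 0 < 35 / 16 - 5 / 2 * u := by linarith
  have hl : 0 < u + 2 := by linarith
  have hr : 0 < 1 - u := by linarith
  have hW : weight u - 5 / 16 = 35 / 16 - 5 / 2 * u := by rw [weight_of_neg hu]; ring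
  have hn : coeff u - 4 / 5 + 6 * weight u - (15 / 2 * (1 - u) - 13 / 10) = 1 / 2 := by
    rw [weight_of_neg hu, coeff_of_neg hu]; ring
  have hm : coeff u - 4 / 5 + 3 * weight u = -(4 / 5) := by
    rw [weight_of_neg hu, coeff_of_neg hu]; ring
  rw [Admissible, hW, hn, hm]
  refine ⟨by positivity, by norm_num, ?_⟩
  rw [coeff_of_neg hu, ← sub_nonneg]
  have hE : 0 ≤ (15 / 2 * u - 479 / 50) * (u + 3 / 4)
      - (-(5 / 2) * ((u + 2) * (1 - u) ^ 2) + (35 / 16 - 5 / 2 * u) * (3 * u ^ 2 - 3)) := by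
    nlinarith [mul_pos (sub_pos.2 h₀) (sub_pos.2 hu),
      mul_pos (mul_pos (sub_pos.2 h₀) (sub_pos.2 hu)) (sub_pos.2 h₀),
      mul_pos (mul_pos (sub_pos.2 h₀) (sub_pos.2 hu)) (sub_pos.2 hu)]
  have key : 0 ≤ 1 / 2 * ((35 / 16 - 5 / 2 * u) * ((u + 2) * (1 - u) ^ 2)) *
      (((15 / 2 * u - 479 / 50) * (u + 3 / 4)
      - (-(5 / 2) * ((u + 2) * (1 - u) ^ 2) + (35 / 16 - 5 / 2 * u) * (3 * u ^ 2 - 3)))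
        / (u + 3 / 4)) := by positivity
  refine key.trans_eq ?_
  generalize hd' : u + 3 / 4 = d at hd ⊢
  obtain rfl : u = d - 3 / 4 := by linarith
  field_simp
  ring

theorem admissible_middle {u : ℝ} (h₀ : 0 < u) (h₁ : u < 1 / 2) :
    Admissible u (-((1 - u) * (23 / 4 - 20 * u + 19 * u ^ 2)))
      (103 / 4 - 78 * u + 57 * u ^ 2) (-13) := by
  have hv : 0 < 1 - 2 * u := by linarith
  have hr : 0 < 1 - u := by linarith
  have hg : 0 < 5 / 2 * (1 - u) * (4 * u ^ 3 + 1) - 5 / 16 := by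
    nlinarith [mul_pos hr (pow_pos h₀ 3)]
  have hE : 0 ≤ (1 - u) ^ 2 * (271949 / 320 * (1 - 2 * u) ^ 13
      + 7086633 / 1280 * (2 * u) * (1 - 2 * u) ^ 12
      + 32951093 / 2560 * (2 * u) ^ 2 * (1 - 2 * u) ^ 11
      + 14118957 / 1280 * (2 * u) ^ 3 * (1 - 2 * u) ^ 10
      + 2356619 / 1280 * (2 * u) ^ 4 * (1 - 2 * u) ^ 9
      + 109826097 / 5120 * (2 * u) ^ 5 * (1 - 2 * u) ^ 8
      + 181258647 / 2048 * (2 * u) ^ 6 * (1 - 2 * u) ^ 7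
      + 1564734267 / 10240 * (2 * u) ^ 7 * (1 - 2 * u) ^ 6
      + 24454941 / 160 * (2 * u) ^ 8 * (1 - 2 * u) ^ 5
      + 992346277 / 10240 * (2 * u) ^ 9 * (1 - 2 * u) ^ 4
      + 403463301 / 10240 * (2 * u) ^ 10 * (1 - 2 * u) ^ 3
      + 100971671 / 10240 * (2 * u) ^ 11 * (1 - 2 * u) ^ 2
      + 1386957 / 1024 * (2 * u) ^ 12 * (1 - 2 * u)
      + 764143 / 10240 * (2 * u) ^ 13) := by positivity
  have hn : 0 < 197 / 10 * (1 - 2 * u) ^ 5 + 259 / 4 * (2 * u) * (1 - 2 * u) ^ 4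
      + 137 * (2 * u) ^ 2 * (1 - 2 * u) ^ 3 + 379 / 2 * (2 * u) ^ 3 * (1 - 2 * u) ^ 2
      + 953 / 8 * (2 * u) ^ 4 * (1 - 2 * u) + 2101 / 80 * (2 * u) ^ 5 := by positivity
  rw [Admissible, weight_of_mem_Ico h₀.le h₁, coeff_of_mem_Ico h₀.le h₁]
  refine ⟨by positivity, hn.trans_eq (by ring), ?_⟩
  rw [← sub_nonneg]
  exact hE.trans_eq (by ring)

theorem admissible_right {u : ℝ} (h₀ : 1 / 2 < u) (h₁ : u < 1) :
    Admissible u (-(1 / 2) * (1 - u)) (1 / 2) (-13) := by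
  have hl : 0 < u + 2 := by linarith
  have hr : 0 < 1 - u := by linarith
  rw [Admissible, weight_of_half_le h₀.le, coeff_of_half_le h₀.le]
  refine ⟨by norm_num; positivity, by linarith, ?_⟩
  have hE : 0 ≤ 25 / 16 * (u + 2) * ((45 / 8 * u - 4 / 5 + 6 * (15 / 8) - -13)
      * (45 / 8 * u - 4 / 5 + 1 / 2) - (45 / 8 * u - 4 / 5 + 3 * (15 / 8)) ^ 2)
      - 1 / 4 * (45 / 8 * u - 4 / 5 + 6 * (15 / 8) - -13) := by
    nlinarith
  nlinarith [mul_nonneg (sq_nonneg (1 - u)) hE]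

theorem tendsto_zero_of_sq_integrable {φ : ℝ → ℝ} (hφ : ContDiff ℝ 1 φ)
    (hφ2 : Integrable fun ξ => φ ξ ^ 2) (hφ'2 : Integrable fun ξ => deriv φ ξ ^ 2) :
    Tendsto φ atBot (nhds 0) ∧ Tendsto φ atTop (nhds 0) := by
  have hc := hφ.continuous
  have hc' := hφ.continuous_deriv le_rfl
  have hderiv : ∀ ξ, HasDerivAt (fun ξ => φ ξ ^ 2) (2 * φ ξ * deriv φ ξ) ξ := fun ξ =>
    (((hφ.differentiable one_ne_zero ξ).hasDerivAt).fun_pow 2).congr_deriv (by norm_num)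
  have hint : Integrable fun ξ => 2 * φ ξ * deriv φ ξ := by
    refine (hφ2.add hφ'2).mono' (by fun_prop) (ae_of_all _ fun ξ => ?_)
    rw [Real.norm_eq_abs, abs_le]
    simp only [Pi.add_apply]
    constructor <;> nlinarith [sq_nonneg (φ ξ + deriv φ ξ), sq_nonneg (φ ξ - deriv φ ξ)]
  have hsq : ∀ l : Filter ℝ, Tendsto (fun ξ => φ ξ ^ 2) l (nhds 0) → Tendsto φ l (nhds 0) := by
    intro l h
    rw [tendsto_zero_iff_abs_tendsto_zero]
    simpa [Function.comp_def, Real.sqrt_sq_eq_abs] using h.sqrt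
  exact ⟨hsq _ (tendsto_zero_of_hasDerivAt_of_integrableOn_Iic (a := 0) (fun ξ _ => hderiv ξ)
      hint.integrableOn hφ2.integrableOn),
    hsq _ (tendsto_zero_of_hasDerivAt_of_integrableOn_Ioi (a := 0) (fun ξ _ => hderiv ξ)
      hint.integrableOn hφ2.integrableOn)⟩

theorem hasDerivAt_leftPotential (u : ℝ) :
    HasDerivAt (fun u : ℝ => -(15 / 4) * (1 - u) ^ 2 - 13 / 10 * u)
      (15 / 2 * (1 - u) - 13 / 10) u :=
  (((((hasDerivAt_id' u).const_sub 1).fun_pow 2).const_mul (-(15 / 4))).sub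
    ((hasDerivAt_id' u).const_mul (13 / 10))).congr_deriv (by norm_num; ring)

theorem hasDerivAt_rightPotential (u : ℝ) : HasDerivAt (fun u : ℝ => -13 * u) (-13) u :=
  ((hasDerivAt_id' u).const_mul (-13)).congr_deriv (by norm_num)

theorem hasDerivAt_leftMultiplier {u : ℝ} (hu : u ≠ -13 / 20) :
    HasDerivAt (fun u : ℝ => 33 / 20 * ((35 / 16 - 5 / 2 * u) * (u + 2) * (1 - u))
        / (-13 / 20 - u))
      ((33 / 20 * (-(5 / 2) * (u + 2) * (1 - u) + (35 / 16 - 5 / 2 * u) * (-1 - 2 * u)))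
          / (-13 / 20 - u)
        + 33 / 20 * ((35 / 16 - 5 / 2 * u) * (u + 2) * (1 - u)) / (-13 / 20 - u) ^ 2) u := by
  have hd : -13 / 20 - u ≠ 0 := sub_ne_zero.2 hu.symm
  have hg := ((hasDerivAt_id' u).const_mul (5 / 2)).const_sub (35 / 16)
  have hN := ((hg.mul ((hasDerivAt_id' u).add_const 2)).mul
    ((hasDerivAt_id' u).const_sub 1)).const_mul (33 / 20)
  refine (hN.div ((hasDerivAt_id' u).const_sub (-13 / 20)) hd).congr_deriv ?_
  simp only [Pi.mul_apply]
  generalize -13 / 20 - u = d at hd ⊢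
  field_simp
  ring

theorem hasDerivAt_innerMultiplier {u : ℝ} (hu : u ≠ -3 / 4) :
    HasDerivAt (fun u : ℝ => -((35 / 16 - 5 / 2 * u) * ((u + 2) * (1 - u) ^ 2)) / (u + 3 / 4))
      (-(-(5 / 2) * ((u + 2) * (1 - u) ^ 2) + (35 / 16 - 5 / 2 * u) * (3 * u ^ 2 - 3))
          / (u + 3 / 4)
        + (35 / 16 - 5 / 2 * u) * ((u + 2) * (1 - u) ^ 2) / (u + 3 / 4) ^ 2) u := by
  have hd : u + 3 / 4 ≠ 0 := fun h => hu (by linarith)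
  have hg := ((hasDerivAt_id' u).const_mul (5 / 2)).const_sub (35 / 16)
  have hN := (hg.mul (((hasDerivAt_id' u).add_const 2).mul
    (((hasDerivAt_id' u).const_sub 1).fun_pow 2))).neg
  refine (hN.div ((hasDerivAt_id' u).add_const (3 / 4)) hd).congr_deriv ?_
  simp only [Pi.mul_apply, Pi.neg_apply]
  generalize u + 3 / 4 = d at hd ⊢
  field_simp
  ring

theorem hasDerivAt_middleMultiplier (u : ℝ) :
    HasDerivAt (fun u : ℝ => -((1 - u) * (23 / 4 - 20 * u + 19 * u ^ 2)))
      (103 / 4 - 78 * u + 57 * u ^ 2) u :=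
  (((hasDerivAt_id' u).const_sub 1).mul ((((hasDerivAt_id' u).const_mul 20).const_sub (23 / 4)).add
    ((hasDerivAt_pow 2 u).const_mul 19))).neg.congr_deriv (by norm_num; ring)

theorem hasDerivAt_rightMultiplier (u : ℝ) :
    HasDerivAt (fun u : ℝ => -(1 / 2) * (1 - u)) (1 / 2) u :=
  (((hasDerivAt_id' u).const_sub 1).const_mul (-(1 / 2))).congr_deriv (by norm_num)

theorem le_integral_density {ν ξ₀ : ℝ} {x φ : ℝ → ℝ} (hx : Differentiable ℝ x)
    (hφ : Differentiable ℝ φ) (hx' : ∀ ξ, 0 < deriv x ξ)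
    (hrange : ∀ ξ, x ξ ∈ Set.Ioo (-2 : ℝ) 1)
    (hode : ∀ ξ, ν * deriv x ξ = (x ξ + 2) * (1 - x ξ) ^ 2)
    (hbot : Tendsto x atBot (nhds (-2))) (htop : Tendsto x atTop (nhds 1))
    (hφbot : Tendsto φ atBot (nhds 0)) (hφtop : Tendsto φ atTop (nhds 0))
    (hξ₀ : x ξ₀ = -7 / 10) (hint : Integrable (density ν (φ ξ₀) x φ)) :
    72 / 5 * φ ξ₀ ^ 2 ≤ ∫ ξ, density ν (φ ξ₀) x φ ξ := by
  have hmono : StrictMono x := strictMono_of_deriv_pos hx'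
  have hex : ∀ v ∈ Set.Ioo (-2 : ℝ) 1, ∃ ξ, x ξ = v := fun v hv =>
    mem_range_of_exists_le_of_exists_ge hx.continuous
      ((hbot.eventually_le_const hv.1).exists) ((htop.eventually_const_le hv.2).exists)
  obtain ⟨ξ₁, hξ₁⟩ := hex 0 (by norm_num)
  obtain ⟨ξ₂, hξ₂⟩ := hex (1 / 2) (by norm_num)
  have h₀₁ : ξ₀ ≤ ξ₁ := hmono.le_iff_le.1 (by rw [hξ₀, hξ₁]; norm_num)
  have h₁₂ : ξ₁ ≤ ξ₂ := hmono.le_iff_le.1 (by rw [hξ₁, hξ₂]; norm_num)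
  set c := φ ξ₀ with hc
  have hii : ∀ a b, IntervalIntegrable (density ν c x φ) volume a b := fun a b =>
    hint.intervalIntegrable
  have hinner := sub_le_integral_density (c := c) h₀₁ hx hφ hx' hode hint
    (fun u hu => hasDerivAt_innerMultiplier (by rw [hξ₀] at hu; intro h; linarith [hu.1]))
    (fun u _ => hasDerivAt_leftPotential u)
    (fun u hu => admissible_inner (by rw [← hξ₀]; exact hu.1) (by rw [← hξ₁]; exact hu.2))
  have hmiddle := sub_le_integral_density (c := c) h₁₂ hx hφ hx' hode hint
    (fun u _ => hasDerivAt_middleMultiplier u) (fun u _ => hasDerivAt_rightPotential u)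
    (fun u hu => admissible_middle (by rw [← hξ₁]; exact hu.1) (by rw [← hξ₂]; exact hu.2))
  rw [hξ₀, hξ₁, ← hc] at hinner
  rw [hξ₁, hξ₂] at hmiddle
  have hfinite : ∀ r, 0 ≤ r →
      c ^ 2 * (-(15 / 4) * (1 - x (ξ₀ - r)) ^ 2 - 13 / 10 * x (ξ₀ - r)) * (-1)
        + 33 / 20 * ((35 / 16 - 5 / 2 * x (ξ₀ - r)) * (x (ξ₀ - r) + 2) * (1 - x (ξ₀ - r)))
          / (-13 / 20 - x (ξ₀ - r)) * (φ (ξ₀ - r) - c) ^ 2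
        + (c ^ 2 * (-13 * x (ξ₂ + r)) - -(1 / 2) * (1 - x (ξ₂ + r)) * (φ (ξ₂ + r) - c) ^ 2)
        - 15 / 4 * c ^ 2
      ≤ ∫ ξ in (ξ₀ - r)..(ξ₂ + r), density ν c x φ ξ := by
    intro r hr
    have hleft := sub_le_integral_density (c := c) (sub_le_self ξ₀ hr) hx hφ hx' hode hint
      (fun u hu => hasDerivAt_leftMultiplier (by rw [hξ₀] at hu; intro h; linarith [hu.2]))
      (fun u _ => hasDerivAt_leftPotential u)
      (fun u hu => admissible_left ((hrange _).1.trans hu.1) (by rw [← hξ₀]; exact hu.2))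
    have hright := sub_le_integral_density (c := c) (le_add_of_nonneg_right hr : ξ₂ ≤ ξ₂ + r)
      hx hφ hx' hode hint
      (fun u _ => hasDerivAt_rightMultiplier u) (fun u _ => hasDerivAt_rightPotential u)
      (fun u hu => admissible_right (by rw [← hξ₂]; exact hu.1) (hu.2.trans (hrange _).2))
    rw [hξ₀, ← hc] at hleft
    rw [hξ₂] at hright
    rw [← intervalIntegral.integral_add_adjacent_intervals (hii _ ξ₀) (hii ξ₀ _),
      ← intervalIntegral.integral_add_adjacent_intervals (hii ξ₀ ξ₁) (hii ξ₁ _),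
      ← intervalIntegral.integral_add_adjacent_intervals (hii ξ₁ ξ₂) (hii ξ₂ _)]
    norm_num at hleft hinner hmiddle hright ⊢
    nlinarith [sq_nonneg (φ ξ₁ - c)]
  have hlimbot : Tendsto (fun r : ℝ => ξ₀ - r) atTop atBot :=
    tendsto_atBot_add_const_left _ _ tendsto_neg_atTop_atBot
  have hlimtop : Tendsto (fun r : ℝ => ξ₂ + r) atTop atTop :=
    tendsto_atTop_add_const_left _ _ tendsto_id
  have hxa := hbot.comp hlimbot
  have hφa := hφbot.comp hlimbot
  have hxb := htop.comp hlimtop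
  have hφb := hφtop.comp hlimtop
  have hlim := (((((((hxa.const_sub 1).pow 2).const_mul (-(15 / 4))).sub
      (hxa.const_mul (13 / 10))).const_mul (c ^ 2)).mul_const (-1)).add
    (((((((hxa.const_mul (5 / 2)).const_sub (35 / 16)).mul (hxa.add_const 2)).mul
      (hxa.const_sub 1)).const_mul (33 / 20)).div (hxa.const_sub (-13 / 20))
        (by norm_num)).mul ((hφa.sub_const c).pow 2))).add
    (((hxb.const_mul (-13)).const_mul (c ^ 2)).sub
      (((hxb.const_sub 1).const_mul (-(1 / 2))).mul ((hφb.sub_const c).pow 2)))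
    |>.sub_const (15 / 4 * c ^ 2)
  have hle := le_of_tendsto_of_tendsto hlim
    (intervalIntegral_tendsto_integral hint hlimbot hlimtop)
    ((eventually_ge_atTop 0).mono hfinite)
  norm_num at hle
  linarith

theorem normalized_estimate {ν : ℝ} {x φ : ℝ → ℝ} (hν : 0 < ν) (hx : ContDiff ℝ 1 x)
    (hφ : ContDiff ℝ 1 φ) (hrange : ∀ ξ, x ξ ∈ Set.Ioo (-2 : ℝ) 1)
    (hode : ∀ ξ, ν * deriv x ξ = (x ξ + 2) * (1 - x ξ) ^ 2)
    (hbot : Tendsto x atBot (nhds (-2))) (htop : Tendsto x atTop (nhds 1))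
    (hφ2 : Integrable fun ξ => φ ξ ^ 2) (hφ'2 : Integrable fun ξ => deriv φ ξ ^ 2) :
    5 / 16 * (∫ ξ, ν * deriv φ ξ ^ 2) + 4 / 5 * (∫ ξ, φ ξ ^ 2 * deriv x ξ)
      ≤ (∫ ξ, ν * weight (x ξ) * deriv φ ξ ^ 2) + (∫ ξ, φ ξ ^ 2 * deriv x ξ * coeff (x ξ))
        + 16 / 25 * (∫ ξ, φ ξ * weight (x ξ) * deriv x ξ) ^ 2 := by
  have hxd := hx.differentiable one_ne_zero
  have hφc := hφ.continuous
  have hxc := hx.continuous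
  have hφc' := hφ.continuous_deriv le_rfl
  have hxc' := hx.continuous_deriv le_rfl
  have hx' : ∀ ξ, 0 < deriv x ξ := fun ξ => by
    have h₁ : 0 < x ξ + 2 := by linarith [(hrange ξ).1]
    have h₂ : 0 < 1 - x ξ := sub_pos.2 (hrange ξ).2
    exact pos_of_mul_pos_right (hode ξ ▸ by positivity) hν.le
  have hx'le : ∀ ξ, deriv x ξ ≤ 27 / ν := fun ξ => by
    have h₁ : 0 < x ξ + 2 := by linarith [(hrange ξ).1]
    have h₂ : 0 < 1 - x ξ := sub_pos.2 (hrange ξ).2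
    rw [le_div_iff₀ hν, mul_comm, hode ξ]
    calc (x ξ + 2) * (1 - x ξ) ^ 2 ≤ 3 * 3 ^ 2 := by
          gcongr <;> linarith [(hrange ξ).1, (hrange ξ).2]
      _ = 27 := by norm_num
  have hWm : Continuous fun ξ => weight (x ξ) := continuous_weight.comp hxc
  have hKm : Measurable fun ξ => coeff (x ξ) := measurable_coeff.comp hxc.measurable
  have hx'int : Integrable (deriv x) := by
    rw [← integrableOn_univ, ← Set.Iic_union_Ioi (a := (0 : ℝ))]
    have hneg : IntegrableOn (fun ξ => deriv x (-ξ)) (Set.Ioi 0) := by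
      refine integrableOn_Ioi_deriv_of_nonneg' (g := fun ξ => -x (-ξ)) (l := 2)
        (fun ξ _ => ?_) (fun ξ _ => (hx' _).le) ?_
      · simpa using ((hxd (-ξ)).hasDerivAt.scomp ξ (hasDerivAt_neg ξ)).fun_neg
      · simpa using (hbot.comp tendsto_neg_atTop_atBot).neg
    refine IntegrableOn.union ?_ (integrableOn_Ioi_deriv_of_nonneg'
      (fun ξ _ => (hxd ξ).hasDerivAt) (fun ξ _ => (hx' ξ).le) htop)
    rw [integrableOn_Iic_iff_integrableOn_Iio]
    simpa using hneg.comp_neg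
  have hI₁ : Integrable fun ξ => ν * deriv φ ξ ^ 2 := hφ'2.const_mul ν
  have hI₂ : Integrable fun ξ => φ ξ ^ 2 * deriv x ξ :=
    hφ2.mul_bdd (c := 27 / ν) (by fun_prop) (ae_of_all _ fun ξ => by
      rw [Real.norm_eq_abs, abs_of_pos (hx' ξ)]; exact hx'le ξ)
  have hI₃ : Integrable fun ξ => ν * weight (x ξ) * deriv φ ξ ^ 2 := by
    refine (hI₁.mul_bdd (c := 20) hWm.aestronglyMeasurable
      (ae_of_all _ fun ξ => abs_weight_le (hrange ξ).1 (hrange ξ).2)).congr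
      (ae_of_all _ fun ξ => ?_)
    ring
  have hI₄ : Integrable fun ξ => φ ξ ^ 2 * deriv x ξ * coeff (x ξ) :=
    hI₂.mul_bdd (c := 1000) hKm.aestronglyMeasurable
      (ae_of_all _ fun ξ => abs_coeff_le (hrange ξ).1 (hrange ξ).2)
  have hI₅ : Integrable fun ξ => φ ξ * weight (x ξ) * deriv x ξ := by
    have h : Integrable fun ξ => φ ξ * deriv x ξ := by
      refine (hI₂.add hx'int).mono' (by fun_prop) (ae_of_all _ fun ξ => ?_)
      rw [Real.norm_eq_abs, abs_mul, abs_of_pos (hx' ξ)]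
      have : |φ ξ| ≤ φ ξ ^ 2 + 1 := by
        rw [abs_le]
        constructor <;> nlinarith [sq_nonneg (φ ξ - 1), sq_nonneg (φ ξ + 1)]
      simpa [add_mul] using mul_le_mul_of_nonneg_right this (hx' ξ).le
    refine (h.mul_bdd (c := 20) hWm.aestronglyMeasurable
      (ae_of_all _ fun ξ => abs_weight_le (hrange ξ).1 (hrange ξ).2)).congr
      (ae_of_all _ fun ξ => ?_)
    ring
  obtain ⟨ξ₀, hξ₀⟩ : ∃ ξ, x ξ = -7 / 10 :=
    mem_range_of_exists_le_of_exists_ge hxc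
      ((hbot.eventually_le_const (by norm_num)).exists)
      ((htop.eventually_const_le (by norm_num)).exists)
  obtain ⟨hφbot, hφtop⟩ := tendsto_zero_of_sq_integrable hφ hφ2 hφ'2
  have hdensity : density ν (φ ξ₀) x φ = fun ξ =>
      ν * weight (x ξ) * deriv φ ξ ^ 2 - 5 / 16 * (ν * deriv φ ξ ^ 2)
        + (φ ξ ^ 2 * deriv x ξ * coeff (x ξ) - 4 / 5 * (φ ξ ^ 2 * deriv x ξ))
        + 6 * φ ξ₀ * (φ ξ * weight (x ξ) * deriv x ξ) := by
    funext ξ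
    rw [density]
    ring
  have hJ₁ : Integrable fun ξ => ν * weight (x ξ) * deriv φ ξ ^ 2
      - 5 / 16 * (ν * deriv φ ξ ^ 2) := hI₃.sub (hI₁.const_mul (5 / 16))
  have hJ₂ : Integrable fun ξ => φ ξ ^ 2 * deriv x ξ * coeff (x ξ)
      - 4 / 5 * (φ ξ ^ 2 * deriv x ξ) := hI₄.sub (hI₂.const_mul (4 / 5))
  have hJ₃ := hI₅.const_mul (6 * φ ξ₀)
  have hmain := le_integral_density hxd (hφ.differentiable one_ne_zero) hx' hrange hode hbot htop
    hφbot hφtop hξ₀ (hdensity ▸ (hJ₁.fun_add hJ₂).fun_add hJ₃)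
  have hsplit : ∫ ξ, density ν (φ ξ₀) x φ ξ =
      ((∫ ξ, ν * weight (x ξ) * deriv φ ξ ^ 2) - 5 / 16 * ∫ ξ, ν * deriv φ ξ ^ 2)
      + ((∫ ξ, φ ξ ^ 2 * deriv x ξ * coeff (x ξ)) - 4 / 5 * ∫ ξ, φ ξ ^ 2 * deriv x ξ)
      + 6 * φ ξ₀ * ∫ ξ, φ ξ * weight (x ξ) * deriv x ξ := by
    rw [hdensity, integral_add (hJ₁.fun_add hJ₂) hJ₃, integral_add hJ₁ hJ₂,
      integral_sub hI₃ (hI₁.const_mul _), integral_sub hI₄ (hI₂.const_mul _)]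
    simp only [integral_const_mul]
  nlinarith [sq_nonneg (4 / 5 * (∫ ξ, φ ξ * weight (x ξ) * deriv x ξ) - 15 / 4 * φ ξ₀),
    sq_nonneg (φ ξ₀)]

end ShockEstimate

/-- Full shock functional estimate (Lemma 4.5). -/
theorem full_shock_functional_estimate
    (μ uminus um σ : ℝ) (hμ : 0 < μ) (huminus : uminus < 0)
    (hum : um = -uminus / 2) (hσ : σ = 3 * um ^ 2)
    (uS : ℝ → ℝ) (huS : ContDiff ℝ 1 uS)
    (hrange : ∀ ξ, uS ξ ∈ Set.Ioo uminus um)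
    (hODE : ∀ ξ, μ * deriv uS ξ = (uS ξ - uminus) * (uS ξ - um) ^ 2)
    (hbot : Tendsto uS atBot (nhds uminus))
    (htop : Tendsto uS atTop (nhds um))
    (w : ℝ → ℝ)
    (hw : ∀ s, w s = if s < 0 then (5 / 2) * um * (um - s)
        else if s < um / 2 then (5 / (2 * um ^ 2)) * (um - s) * (4 * s ^ 3 + um ^ 3)
        else (15 / 8) * um ^ 2)
    (φ : ℝ → ℝ) (hφ : ContDiff ℝ 1 φ)
    (hφ2 : Integrable (fun ξ => (φ ξ) ^ 2))
    (hφ'2 : Integrable (fun ξ => (deriv φ ξ) ^ 2))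
    (hφ4 : Integrable (fun ξ => (φ ξ) ^ 4 * deriv uS ξ))
    (Xdot : ℝ)
    (hX : Xdot = (32 / (25 * um ^ 2)) * ∫ ξ, φ ξ * w (uS ξ) * deriv uS ξ) :
    (5 / 16) * um ^ 2 * (∫ ξ, μ * (deriv φ ξ) ^ 2)
      + (4 / 5) * um ^ 3 * (∫ ξ, (φ ξ) ^ 2 * deriv uS ξ)
      + (25 / 64) * um ^ 2 * Xdot ^ 2
      + (3 / 4) * (∫ ξ, (φ ξ) ^ 4 * |deriv w (uS ξ)| * deriv uS ξ)
    ≤ (∫ ξ, μ * w (uS ξ) * (deriv φ ξ) ^ 2)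
      + (∫ ξ, (φ ξ) ^ 2 * deriv uS ξ *
          (σ * deriv w (uS ξ) - 3 * (uS ξ) ^ 2 * deriv w (uS ξ)
            + 3 * uS ξ * w (uS ξ) - (deriv (deriv w) (uS ξ) / 2) * μ * deriv uS ξ))
      + Xdot * (∫ ξ, φ ξ * w (uS ξ) * deriv uS ξ)
      - (3 / 4) * (∫ ξ, (φ ξ) ^ 4 * deriv w (uS ξ) * deriv uS ξ) := by
  have hm : 0 < um := by linarith
  have hu : uminus = -2 * um := by linarith
  subst hσ hu
  have hne := hm.ne'
  let x : ℝ → ℝ := fun ξ => uS ξ / um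
  have hux : ∀ ξ, uS ξ = um * x ξ := fun ξ => by simp only [x]; field_simp
  have hux' : ∀ ξ, deriv uS ξ = um * deriv x ξ := fun ξ => by
    simp only [x, deriv_div_const]
    field_simp
  have hw₀ : w = fun s => um ^ 2 * ShockEstimate.weight (s / um) := by
    funext s
    have h₁ : s / um < 0 ↔ s < 0 := by rw [div_lt_iff₀ hm, zero_mul]
    have h₂ : s / um < 1 / 2 ↔ s < um / 2 := by
      rw [div_lt_iff₀ hm, one_div_mul_eq_div]
    simp only [hw, ShockEstimate.weight, h₁, h₂]
    split_ifs <;> field_simp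
  have hw₁ : deriv w = fun s => um * ShockEstimate.weightDeriv (s / um) := by
    funext s
    rw [hw₀]
    refine ((((ShockEstimate.hasDerivAt_weight (s / um)).comp s
      ((hasDerivAt_id' s).div_const um)).const_mul (um ^ 2)).congr_deriv ?_).deriv
    field_simp
  have hw₂ : deriv (deriv w) = fun s => ShockEstimate.weightDeriv₂ (s / um) := by
    funext s
    rw [hw₁]
    refine ((((ShockEstimate.hasDerivAt_weightDeriv (s / um)).comp s
      ((hasDerivAt_id' s).div_const um)).const_mul um).congr_deriv ?_).deriv
    field_simp
  have hode : ∀ ξ, μ / um ^ 2 * deriv x ξ = (x ξ + 2) * (1 - x ξ) ^ 2 := fun ξ => by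
    have h := hODE ξ
    rw [hux', hux] at h
    rw [div_mul_eq_mul_div, div_eq_iff (by positivity)]
    apply mul_left_cancel₀ hne
    linear_combination h
  have key := ShockEstimate.normalized_estimate (ν := μ / um ^ 2) (x := x) (by positivity)
    (huS.div_const um) hφ
    (fun ξ => ⟨by rw [lt_div_iff₀ hm]; exact (hrange ξ).1,
      by rw [div_lt_one hm]; exact (hrange ξ).2⟩) hode
    (by have h := hbot.div_const um; rwa [mul_div_cancel_right₀ _ hne] at h)
    (by simpa [hne] using htop.div_const um) hφ2 hφ'2
  have e₁ : ∫ ξ, μ * deriv φ ξ ^ 2 = um ^ 2 * ∫ ξ, μ / um ^ 2 * deriv φ ξ ^ 2 := by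
    rw [← integral_const_mul]
    refine integral_congr_ae (ae_of_all _ fun ξ => ?_)
    beta_reduce
    field_simp
  have e₂ : ∫ ξ, φ ξ ^ 2 * deriv uS ξ = um * ∫ ξ, φ ξ ^ 2 * deriv x ξ := by
    rw [← integral_const_mul]
    refine integral_congr_ae (ae_of_all _ fun ξ => ?_)
    beta_reduce
    rw [hux']
    ring
  have e₃ : ∫ ξ, μ * w (uS ξ) * deriv φ ξ ^ 2
      = um ^ 4 * ∫ ξ, μ / um ^ 2 * ShockEstimate.weight (x ξ) * deriv φ ξ ^ 2 := by
    rw [← integral_const_mul]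
    refine integral_congr_ae (ae_of_all _ fun ξ => ?_)
    beta_reduce
    simp only [hw₀, x]
    field_simp
  have e₄ : ∫ ξ, φ ξ ^ 2 * deriv uS ξ * (3 * um ^ 2 * deriv w (uS ξ)
        - 3 * uS ξ ^ 2 * deriv w (uS ξ) + 3 * uS ξ * w (uS ξ)
        - deriv (deriv w) (uS ξ) / 2 * μ * deriv uS ξ)
      = um ^ 4 * ∫ ξ, φ ξ ^ 2 * deriv x ξ * ShockEstimate.coeff (x ξ) := by
    rw [← integral_const_mul]
    refine integral_congr_ae (ae_of_all _ fun ξ => ?_)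
    beta_reduce
    have hxξ : um * x ξ / um = x ξ := by field_simp
    have h : μ * deriv x ξ = um ^ 2 * ((x ξ + 2) * (1 - x ξ) ^ 2) := by
      rw [← hode ξ]
      field_simp
    rw [hw₂, hw₁, hw₀, hux', hux, ShockEstimate.coeff]
    simp only [hxξ]
    linear_combination (-(φ ξ ^ 2 * um ^ 2 * deriv x ξ
      * ShockEstimate.weightDeriv₂ (x ξ) / 2)) * h
  have e₅ : ∫ ξ, φ ξ * w (uS ξ) * deriv uS ξ
      = um ^ 3 * ∫ ξ, φ ξ * ShockEstimate.weight (x ξ) * deriv x ξ := by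
    rw [← integral_const_mul]
    refine integral_congr_ae (ae_of_all _ fun ξ => ?_)
    beta_reduce
    rw [hux']
    simp only [hw₀, x]
    ring
  have e₆ : ∫ ξ, φ ξ ^ 4 * |deriv w (uS ξ)| * deriv uS ξ
      = -∫ ξ, φ ξ ^ 4 * deriv w (uS ξ) * deriv uS ξ := by
    rw [← integral_neg]
    refine integral_congr_ae (ae_of_all _ fun ξ => ?_)
    beta_reduce
    rw [abs_of_nonpos]
    · ring
    · rw [hw₁]
      exact mul_nonpos_of_nonneg_of_nonpos hm.le (ShockEstimate.weightDeriv_nonpos _)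
  rw [e₅] at hX
  rw [e₁, e₂, e₃, e₄, e₅, e₆, hX]
  generalize (∫ ξ, φ ξ * ShockEstimate.weight (x ξ) * deriv x ξ) = J at key ⊢
  have hJ₁ : 25 / 64 * um ^ 2 * (32 / (25 * um ^ 2) * (um ^ 3 * J)) ^ 2
      = um ^ 4 * (16 / 25 * J ^ 2) := by
    field_simp
    ring
  have hJ₂ : 32 / (25 * um ^ 2) * (um ^ 3 * J) * (um ^ 3 * J) = um ^ 4 * (32 / 25 * J ^ 2) := by
    field_simp
  rw [hJ₁, hJ₂]
  linarith [mul_le_mul_of_nonneg_left key (by positivity : 0 ≤ um ^ 4)]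
end
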